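/- arXiv:2401.04466 — 5 statements merged into one kernel-verified Lean document; each statement's English description precedes it below -/
import Mathlib

section
/- Let I ⊂ ℝ be an interval, m, n ∈ ℕ, v ∈ I^m, w ∈ I^n, and f : I → ℝ. If f is nonincreasing and v ≺ w, then f⃗(w) ≺ f⃗(v), where f⃗(v) := (f(v_1),…,f(v_m)). -/
/-- The nondecreasing rearrangement of a vector. -/
noncomputable def sortAsc {n : ℕ} (v : Fin n → ℝ) : Fin n → ℝ :=
  v ∘ Tuple.sort v

/-- The nonincreasing rearrangement of a vector. -/
noncomputable def sortDesc {n : ℕ} (v : Fin n → ℝ) : Fin n → ℝ :=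
  fun k => sortAsc v k.rev

/-- `v ∈ ℝ^m` is ordered majorized by `w ∈ ℝ^n` (`m ≤ n`):
`v↓_k ≤ w↓_k` for all `k ∈ {1,…,m}`. -/
def OrdMaj {m n : ℕ} (h : m ≤ n) (v : Fin m → ℝ) (w : Fin n → ℝ) : Prop :=
  ∀ k : Fin m, sortDesc v k ≤ sortDesc w (Fin.castLE h k)

/-- `v ∈ ℝ^m` is ordered minorized by `w ∈ ℝ^n` (`m ≤ n`):
`v↑_k ≥ w↑_k` for all `k ∈ {1,…,m}`. -/
def OrdMin {m n : ℕ} (h : m ≤ n) (v : Fin m → ℝ) (w : Fin n → ℝ) : Prop :=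
  ∀ k : Fin m, sortAsc w (Fin.castLE h k) ≤ sortAsc v k

/-- `v` is embedded in `w`: it is both ordered majorized and ordered minorized by `w`. -/
def Embedded {m n : ℕ} (h : m ≤ n) (v : Fin m → ℝ) (w : Fin n → ℝ) : Prop :=
  OrdMaj h v w ∧ OrdMin h v w

/-- The vector `(v_1,…,v_m,x,…,x)` of length `n` (`x` repeated `n - m` times). -/
def padRight {m n : ℕ} (v : Fin m → ℝ) (x : ℝ) : Fin n → ℝ :=
  fun i => if h : (i : ℕ) < m then v ⟨i, h⟩ else x

/-- General order majorization `v ≺ w` for vectors of possibly different lengths: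
for `m ≤ n` it means `v↓_k ≤ w↓_k` for `k ∈ {1,…,m}`;
for `m > n` it means `v↑_k ≤ w↑_k` for `k ∈ {1,…,n}`. -/
def Prec {m n : ℕ} (v : Fin m → ℝ) (w : Fin n → ℝ) : Prop :=
  if h : m ≤ n then ∀ k : Fin m, sortDesc v k ≤ sortDesc w (Fin.castLE h k)
  else ∀ k : Fin n, sortAsc v (Fin.castLE (not_le.mp h).le k) ≤ sortAsc w k

theorem sortAsc_comp_anti {I : Set ℝ} {n : ℕ} {v : Fin n → ℝ} (hv : ∀ i, v i ∈ I)
    {f : ℝ → ℝ} (hf : AntitoneOn f I) (k : Fin n) :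
    sortAsc (f ∘ v) k = f (sortDesc v k) := by
  have h1 : Monotone ((f ∘ v) ∘ (Fin.revPerm.trans (Tuple.sort v))) := by
    intro a b hab
    exact hf (hv _) (hv _) (Tuple.monotone_sort v (Fin.rev_le_rev.mpr hab))
  have h2 := Tuple.unique_monotone (Tuple.monotone_sort (f ∘ v)) h1
  exact congrFun h2 k

theorem sortDesc_comp_anti {I : Set ℝ} {n : ℕ} {v : Fin n → ℝ} (hv : ∀ i, v i ∈ I)
    {f : ℝ → ℝ} (hf : AntitoneOn f I) (k : Fin n) :
    sortDesc (f ∘ v) k = f (sortAsc v k) := by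
  have h := sortAsc_comp_anti hv hf k.rev
  simpa [sortDesc] using h

/-- if `f` is nonincreasing and `v ≺ w`, then `f⃗(w) ≺ f⃗(v)`. -/
theorem prec_comp_of_antitone (I : Set ℝ) (hI : I.OrdConnected) (m n : ℕ)
    (v : Fin m → ℝ) (w : Fin n → ℝ) (hv : ∀ i, v i ∈ I) (hw : ∀ i, w i ∈ I)
    (f : ℝ → ℝ) (hf : AntitoneOn f I) (hvw : Prec v w) :
    Prec (f ∘ w) (f ∘ v) := by
  have hva : ∀ k, sortAsc v k ∈ I := fun k => hv _
  have hwa : ∀ k, sortAsc w k ∈ I := fun k => hw _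
  unfold Prec at hvw ⊢
  by_cases h : m ≤ n
  · rw [dif_pos h] at hvw
    by_cases h' : n ≤ m
    · obtain rfl : m = n := le_antisymm h h'
      rw [dif_pos h']
      intro k
      rw [sortDesc_comp_anti hw hf, sortDesc_comp_anti hv hf]
      refine hf (hva _) (hwa _) ?_
      have := hvw k.rev
      simpa [sortDesc] using this
    · rw [dif_neg h']
      intro k
      rw [sortAsc_comp_anti hw hf, sortAsc_comp_anti hv hf]
      exact hf (hva _) (hwa _) (hvw k)
  · rw [dif_neg h] at hvw
    rw [dif_pos (not_le.mp h).le]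
    intro k
    rw [sortDesc_comp_anti hw hf, sortDesc_comp_anti hv hf]
    exact hf (hva _) (hwa _) (hvw k)
end

section
/- Let I ⊂ ℝ be an interval, n ∈ ℕ, and μ : I^n → ℝ be continuous, symmetric, and strictly increasing in each of its variables. Then for every w ∈ I^n, m < n, and v ∈ I^m with v ⊲ w, the equation μ(v_1,…,v_m, x,…,x) = μ(w_1,…,w_n) (with x repeated n−m times) has a unique solution x₀ ∈ I; moreover min(w) ≤ x₀ ≤ max(w). -/
theorem aux_mono {I : Set ℝ} {n : ℕ} {μ : (Fin n → ℝ) → ℝ}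
    (hmono : ∀ u : Fin n → ℝ, (∀ i, u i ∈ I) → ∀ i : Fin n,
      StrictMonoOn (fun t => μ (Function.update u i t)) I)
    {u u' : Fin n → ℝ} (hu : ∀ i, u i ∈ I) (hu' : ∀ i, u' i ∈ I) (h : ∀ i, u i ≤ u' i) :
    μ u ≤ μ u' := by
  classical
  have key : ∀ s : Finset (Fin n), μ u ≤ μ (s.piecewise u' u) := by
    intro s
    induction s using Finset.induction_on with
    | empty => simp
    | insert a s ha ih =>
      refine ih.trans ?_
      rw [Finset.piecewise_insert]
      have hp : ∀ i, s.piecewise u' u i ∈ I := by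
        intro i
        by_cases hi : i ∈ s <;> simp [hi, hu, hu']
      have h1 := (hmono _ hp a).monotoneOn (hu a) (hu' a) (h a)
      have h2 : Function.update (s.piecewise u' u) a (u a) = s.piecewise u' u := by
        rw [Function.update_eq_self_iff]
        simp [ha]
      simpa only [h2] using h1
  simpa using key Finset.univ

def auxPerm {m n : ℕ} (h : m ≤ n) (τ : Equiv.Perm (Fin m)) : Equiv.Perm (Fin n) where
  toFun i := if hi : (i : ℕ) < m then Fin.castLE h (τ ⟨i, hi⟩) else i
  invFun i := if hi : (i : ℕ) < m then Fin.castLE h (τ.symm ⟨i, hi⟩) else i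
  left_inv i := by
    by_cases hi : (i : ℕ) < m <;> simp [hi]
  right_inv i := by
    by_cases hi : (i : ℕ) < m <;> simp [hi]

theorem aux_pad_comp {m n : ℕ} (h : m ≤ n) (τ : Equiv.Perm (Fin m)) (v : Fin m → ℝ) (x : ℝ) :
    (padRight (n := n) (v ∘ τ) x) = padRight v x ∘ auxPerm h τ := by
  funext i
  by_cases hi : (i : ℕ) < m <;> simp [hi, padRight, auxPerm]

theorem aux_pad_mem {I : Set ℝ} {m n : ℕ} {v : Fin m → ℝ} (hv : ∀ i, v i ∈ I) {x : ℝ}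
    (hx : x ∈ I) : ∀ i, padRight (n := n) v x i ∈ I := by
  intro i
  by_cases hi : (i : ℕ) < m <;> simp [hi, padRight, hv, hx]

/-- for `μ : I^n → ℝ` continuous, symmetric, strictly increasing in each
variable, `m < n`, and `v ∈ I^m` embedded in `w ∈ I^n`, the equation
`μ(v_1,…,v_m,x,…,x) = μ(w)` has a unique solution `x₀ ∈ I`, and
`min(w) ≤ x₀ ≤ max(w)`. -/
theorem exists_unique_solution (I : Set ℝ) (hI : I.OrdConnected) (n m : ℕ) (hmn : m < n)
    (μ : (Fin n → ℝ) → ℝ)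
    (hcont : ContinuousOn μ {u : Fin n → ℝ | ∀ i, u i ∈ I})
    (hsym : ∀ u : Fin n → ℝ, (∀ i, u i ∈ I) → ∀ σ : Equiv.Perm (Fin n), μ (u ∘ σ) = μ u)
    (hmono : ∀ u : Fin n → ℝ, (∀ i, u i ∈ I) → ∀ i : Fin n,
      StrictMonoOn (fun t => μ (Function.update u i t)) I)
    (w : Fin n → ℝ) (hw : ∀ i, w i ∈ I)
    (v : Fin m → ℝ) (hv : ∀ i, v i ∈ I)
    (hvw : Embedded hmn.le v w) :
    ∃ x₀ : ℝ, x₀ ∈ I ∧ μ (padRight v x₀) = μ w ∧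
      (⨅ i, w i) ≤ x₀ ∧ x₀ ≤ (⨆ i, w i) ∧
      ∀ y : ℝ, y ∈ I → μ (padRight v y) = μ w → y = x₀ := by
  classical
  have hne : Nonempty (Fin n) := ⟨⟨m, hmn⟩⟩
  obtain ⟨ia, ha⟩ := exists_eq_ciInf_of_finite (f := w)
  obtain ⟨ib, hb⟩ := exists_eq_ciSup_of_finite (f := w)
  have hamin : ∀ i, w ia ≤ w i := fun i => ha ▸ ciInf_le (Set.finite_range w).bddBelow i
  have hbmax : ∀ i, w i ≤ w ib := fun i => hb ▸ le_ciSup (Set.finite_range w).bddAbove i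
  have hup : μ w ≤ μ (padRight v (w ib)) := by
    rw [← hsym _ (aux_pad_mem hv (hw ib)) (auxPerm hmn.le (Tuple.sort v)), ← aux_pad_comp,
      ← hsym w hw (Tuple.sort w)]
    refine aux_mono hmono (fun i => hw _) (aux_pad_mem (fun i => hv _) (hw ib)) ?_
    intro i
    by_cases hi : (i : ℕ) < m
    · have := hvw.2 ⟨i, hi⟩
      simpa [padRight, hi, sortAsc] using this
    · simpa [padRight, hi] using hbmax _
  have hlo : μ (padRight v (w ia)) ≤ μ w := by
    rw [← hsym _ (aux_pad_mem hv (hw ia)) (auxPerm hmn.le (Fin.revPerm.trans (Tuple.sort v))),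
      ← aux_pad_comp, ← hsym w hw (Fin.revPerm.trans (Tuple.sort w))]
    refine aux_mono hmono (aux_pad_mem (fun i => hv _) (hw ia)) (fun i => hw _) ?_
    intro i
    by_cases hi : (i : ℕ) < m
    · have := hvw.1 ⟨i, hi⟩
      simpa [padRight, hi, sortAsc, sortDesc] using this
    · simpa [padRight, hi] using hamin _
  have hstrict : ∀ x ∈ I, ∀ y ∈ I, x < y →
      μ (padRight (n := n) v x) < μ (padRight (n := n) v y) := by
    intro x hx y hy hxy
    have hpx := aux_pad_mem (n := n) hv hx
    have h1 := hmono _ hpx ⟨m, hmn⟩ hx hy hxy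
    have h2 : Function.update (padRight (n := n) v x) ⟨m, hmn⟩ x = padRight v x := by
      rw [Function.update_eq_self_iff]
      simp [padRight]
    simp only [h2] at h1
    refine h1.trans_le (aux_mono hmono ?_ (aux_pad_mem hv hy) ?_)
    · intro i
      by_cases hi : i = ⟨m, hmn⟩
      · subst hi
        simpa using hy
      · simpa [hi] using hpx i
    · intro i
      by_cases hi : i = ⟨m, hmn⟩
      · subst hi
        simp [padRight]
      · rw [Function.update_of_ne hi]
        by_cases him : (i : ℕ) < m <;> simp [padRight, him, hxy.le]
  have hsub : Set.Icc (w ia) (w ib) ⊆ I := hI.out (hw ia) (hw ib)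
  have hc : ContinuousOn (fun x => μ (padRight (n := n) v x)) (Set.Icc (w ia) (w ib)) := by
    refine hcont.comp (Continuous.continuousOn ?_) (fun x hx => aux_pad_mem hv (hsub hx))
    refine continuous_pi fun i => ?_
    by_cases hi : (i : ℕ) < m
    · simp only [padRight, hi, dite_true]
      exact continuous_const
    · simp only [padRight, hi, dite_false]
      exact continuous_id
  obtain ⟨x, hx, hxe⟩ := intermediate_value_Icc (hamin ib) hc ⟨hlo, hup⟩
  refine ⟨x, hsub hx, hxe, ha ▸ hx.1, hb ▸ hx.2, fun y hy hye => ?_⟩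
  have hxe' : μ (padRight v x) = μ w := hxe
  rcases lt_trichotomy y x with h | h | h
  · have := hstrict y hy x (hsub hx) h
    linarith
  · exact h
  · have := hstrict x (hsub hx) y hy h
    linarith
end

section
/- Let X be a metric space, I ⊂ ℝ an interval, m < n ∈ ℕ, μ : I^n → ℝ continuous, symmetric, and strictly increasing in each of its variables, and f_1,…,f_m, g_1,…,g_n : X → I be continuous functions such that (f_1(x),…,f_m(x)) ⊲ (g_1(x),…,g_n(x)) for all x ∈ X. Then the unique function α : X → I satisfying μ(f_1(x),…,f_m(x), α(x),…,α(x)) = μ(g_1(x),…,g_n(x)) for all x ∈ X (with α(x) repeated n−m times) is continuous. -/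
theorem mono_aux {I : Set ℝ} {n : ℕ} {μ : (Fin n → ℝ) → ℝ}
    (hmono : ∀ u : Fin n → ℝ, (∀ i, u i ∈ I) → ∀ i : Fin n,
      StrictMonoOn (fun t => μ (Function.update u i t)) I)
    {u v : Fin n → ℝ} (hu : ∀ i, u i ∈ I) (hv : ∀ i, v i ∈ I) (huv : ∀ i, u i ≤ v i) :
    μ u ≤ μ v := by
  classical
  have key : ∀ s : Finset (Fin n), μ u ≤ μ (s.piecewise v u) := by
    intro s
    induction s using Finset.induction_on with
    | empty => simp
    | insert j s hj ih =>
      have hp : ∀ i, s.piecewise v u i ∈ I := by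
        intro i
        by_cases h : i ∈ s <;> simp [h, hu, hv]
      rw [Finset.piecewise_insert]
      have h1 := (hmono _ hp j).monotoneOn (hu j) (hv j) (huv j)
      have h2 : Function.update (s.piecewise v u) j (u j) = s.piecewise v u := by
        rw [Function.update_eq_self_iff]
        simp [hj]
      simp only [h2] at h1
      exact ih.trans h1
  simpa using key Finset.univ

theorem padRight_mem {I : Set ℝ} {m n : ℕ} {v : Fin m → ℝ} {t : ℝ} (hv : ∀ i, v i ∈ I)
    (ht : t ∈ I) : ∀ i, (padRight v t : Fin n → ℝ) i ∈ I := by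
  intro i
  unfold padRight
  split_ifs
  · exact hv _
  · exact ht

theorem padRight_strict {I : Set ℝ} {m n : ℕ} (hmn : m < n) {μ : (Fin n → ℝ) → ℝ}
    (hmono : ∀ u : Fin n → ℝ, (∀ i, u i ∈ I) → ∀ i : Fin n,
      StrictMonoOn (fun t => μ (Function.update u i t)) I)
    {v : Fin m → ℝ} (hv : ∀ i, v i ∈ I) : StrictMonoOn (fun t => μ (padRight v t)) I := by
  intro a ha b hb hab
  have hpa : ∀ i, (padRight v a : Fin n → ℝ) i ∈ I := padRight_mem hv ha
  have h1 := hmono _ hpa ⟨m, hmn⟩ ha hb hab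
  have h2 : Function.update (padRight v a : Fin n → ℝ) ⟨m, hmn⟩ a = padRight v a := by
    rw [Function.update_eq_self_iff]
    simp [padRight]
  simp only [h2] at h1
  refine lt_of_lt_of_le h1 (mono_aux hmono ?_ (padRight_mem hv hb) ?_)
  · intro i
    by_cases h : i = ⟨m, hmn⟩
    · subst h; simpa using hb
    · simpa [Function.update_of_ne h] using hpa i
  · intro i
    by_cases h : i = ⟨m, hmn⟩
    · subst h; simp [padRight]
    · rw [Function.update_of_ne h]
      unfold padRight
      split_ifs
      · exact le_rfl
      · exact hab.le

/-- Implicit function theorem, continuity: if moreover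
`μ, f_1,…,f_m, g_1,…,g_n` are continuous, then the unique solution `α : X → I` of
`μ(f_1(x),…,f_m(x),α(x),…,α(x)) = μ(g_1(x),…,g_n(x))` is continuous. -/
theorem implicit_function_theorem_continuity (X : Type*) [MetricSpace X]
    (I : Set ℝ) (hI : I.OrdConnected) (n m : ℕ) (hmn : m < n)
    (μ : (Fin n → ℝ) → ℝ)
    (hcont : ContinuousOn μ {u : Fin n → ℝ | ∀ i, u i ∈ I})
    (hsym : ∀ u : Fin n → ℝ, (∀ i, u i ∈ I) → ∀ σ : Equiv.Perm (Fin n), μ (u ∘ σ) = μ u)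
    (hmono : ∀ u : Fin n → ℝ, (∀ i, u i ∈ I) → ∀ i : Fin n,
      StrictMonoOn (fun t => μ (Function.update u i t)) I)
    (f : Fin m → X → ℝ) (g : Fin n → X → ℝ)
    (hf : ∀ i x, f i x ∈ I) (hg : ∀ j x, g j x ∈ I)
    (hfc : ∀ i, Continuous (f i)) (hgc : ∀ j, Continuous (g j))
    (hfg : ∀ x : X, Embedded hmn.le (fun i => f i x) (fun j => g j x))
    (α : X → ℝ) (hαI : ∀ x, α x ∈ I)
    (hα : ∀ x, μ (padRight (fun i => f i x) (α x)) = μ (fun j => g j x)) :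
    Continuous α := by
  have hG : Continuous fun x => μ (fun j => g j x) :=
    hcont.comp_continuous (continuous_pi hgc) (fun x j => hg j x)
  have hF : ∀ b ∈ I, Continuous fun x => μ (padRight (fun i => f i x) b) := by
    intro b hb
    refine hcont.comp_continuous (continuous_pi fun i => ?_)
      (fun x => padRight_mem (fun i => hf i x) hb)
    unfold padRight
    split_ifs
    · exact hfc _
    · exact continuous_const
  have hS := fun x => padRight_strict hmn hmono (v := fun i => f i x) (fun i => hf i x)
  rw [continuous_iff_continuousAt]
  intro x₀
  refine tendsto_order.2 ⟨fun b hb => ?_, fun b hb => ?_⟩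
  · by_cases hbI : b ∈ I
    · have h0 := hS x₀ hbI (hαI x₀) hb
      simp only [hα] at h0
      filter_upwards [(hF b hbI).continuousAt.eventually_lt hG.continuousAt h0] with x hx
      rw [← hα x] at hx
      exact ((hS x).lt_iff_lt hbI (hαI x)).1 hx
    · refine Filter.Eventually.of_forall fun x => ?_
      by_contra h
      exact hbI (hI.out (hαI x) (hαI x₀) ⟨not_lt.1 h, hb.le⟩)
  · by_cases hbI : b ∈ I
    · have h0 := hS x₀ (hαI x₀) hbI hb
      simp only [hα] at h0
      filter_upwards [hG.continuousAt.eventually_lt (hF b hbI).continuousAt h0] with x hx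
      rw [← hα x] at hx
      exact ((hS x).lt_iff_lt (hαI x) hbI).1 hx
    · refine Filter.Eventually.of_forall fun x => ?_
      by_contra h
      exact hbI (hI.out (hαI x₀) (hαI x) ⟨hb.le, not_lt.1 h⟩)
end

section
/- Let n, k ∈ ℕ, I ⊂ ℝ be an interval, μ : I^n → ℝ continuous, symmetric, and strictly increasing in each variable, M = (M_1,…,M_n) a sequence of symmetric continuous k-variable means on I, and S = (S_1,…,S_m) (m < n) a sequence of symmetric continuous k-variable means on I with (S_1(v),…,S_m(v)) ⊲ (M_1(v),…,M_n(v)) for all v ∈ I^k. Then the function K := 𝒯_{S,M}(μ) : I^k → I, defined so that K(v) is the unique solution x of μ(S_1(v),…,S_m(v), x,…,x) = μ(M_1(v),…,M_n(v)) (with x repeated n−m times), satisfies the mean property min(v) ≤ K(v) ≤ max(v) for all v ∈ I^k. -/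
theorem mu_mono_aux {n : ℕ} {I : Set ℝ} {μ : (Fin n → ℝ) → ℝ}
    (hμmono : ∀ u : Fin n → ℝ, (∀ i, u i ∈ I) → ∀ i : Fin n,
      StrictMonoOn (fun t => μ (Function.update u i t)) I)
    {u w : Fin n → ℝ} (hu : ∀ i, u i ∈ I) (hw : ∀ i, w i ∈ I) (huw : ∀ i, u i ≤ w i) :
    μ u ≤ μ w := by
  have key : ∀ s : Finset (Fin n), μ u ≤ μ (s.piecewise w u) := by
    intro s
    induction s using Finset.induction_on with
    | empty => simp
    | insert j s hj ih =>
      refine ih.trans ?_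
      rw [Finset.piecewise_insert]
      have hp : ∀ i, s.piecewise w u i ∈ I := by
        intro i
        by_cases h : i ∈ s
        · simpa [h] using hw i
        · simpa [h] using hu i
      have h := (hμmono _ hp j).monotoneOn (hu j) (hw j) (huw j)
      have e : Function.update (s.piecewise w u) j (u j) = s.piecewise w u := by
        rw [Function.update_eq_self_iff]
        simp [hj]
      simpa only [e] using h
  simpa using key Finset.univ

theorem mu_strict_aux {n : ℕ} {I : Set ℝ} {μ : (Fin n → ℝ) → ℝ}
    (hμmono : ∀ u : Fin n → ℝ, (∀ i, u i ∈ I) → ∀ i : Fin n,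
      StrictMonoOn (fun t => μ (Function.update u i t)) I)
    {u w : Fin n → ℝ} (hu : ∀ i, u i ∈ I) (hw : ∀ i, w i ∈ I) (huw : ∀ i, u i ≤ w i)
    (i : Fin n) (hi : u i < w i) : μ u < μ w := by
  have h1 : μ u ≤ μ (Function.update w i (u i)) := by
    apply mu_mono_aux hμmono hu
    · intro j
      by_cases h : j = i
      · subst h; simpa using hu j
      · simpa [h] using hw j
    · intro j
      by_cases h : j = i
      · subst h; simp
      · simpa [h] using huw j
  have h2 := hμmono w hw i (hu i) (hw i) hi
  simp only [Function.update_eq_self] at h2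
  exact h1.trans_lt h2

theorem padRight_perm_aux {m n : ℕ} (hmn : m < n) (s : Fin m → ℝ) (x : ℝ)
    (τ : Equiv.Perm (Fin m)) :
    ∃ σ : Equiv.Perm (Fin n), (padRight (s ∘ τ) x : Fin n → ℝ) = padRight s x ∘ σ := by
  let f : Fin m ≃ {i : Fin n // (i : ℕ) < m} :=
    { toFun := fun j => ⟨⟨j, j.2.trans hmn⟩, j.2⟩
      invFun := fun i => ⟨i.1, i.2⟩
      left_inv := fun _ => rfl
      right_inv := fun _ => rfl }
  refine ⟨τ.extendDomain f, ?_⟩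
  funext i
  by_cases h : (i : ℕ) < m
  · have e := Equiv.Perm.extendDomain_apply_subtype τ f h
    simp only [Function.comp, e]
    simp [padRight, h, f]
  · have e := Equiv.Perm.extendDomain_apply_not_subtype τ f h
    simp only [Function.comp, e]
    simp [padRight, h]

/-- for `μ ∈ CS_n(I)`, `M` a sequence of `n` symmetric continuous
`k`-variable means on `I`, and `S ∈ E_m(M)` (`m < n`), the function `K = 𝒯_{S,M}(μ)`
defined by `μ(S_1(v),…,S_m(v),K(v),…,K(v)) = μ(M_1(v),…,M_n(v))` satisfies the mean
property `min(v) ≤ K(v) ≤ max(v)`. -/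
theorem T_mean_property (n k m : ℕ) (hk : 0 < k) (hmn : m < n)
    (I : Set ℝ) (hI : I.OrdConnected)
    (μ : (Fin n → ℝ) → ℝ)
    (hμcont : ContinuousOn μ {u : Fin n → ℝ | ∀ i, u i ∈ I})
    (hμsym : ∀ u : Fin n → ℝ, (∀ i, u i ∈ I) → ∀ σ : Equiv.Perm (Fin n), μ (u ∘ σ) = μ u)
    (hμmono : ∀ u : Fin n → ℝ, (∀ i, u i ∈ I) → ∀ i : Fin n,
      StrictMonoOn (fun t => μ (Function.update u i t)) I)
    (M : Fin n → (Fin k → ℝ) → ℝ)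
    (hMmean : ∀ j v, (∀ i, v i ∈ I) → (⨅ i, v i) ≤ M j v ∧ M j v ≤ (⨆ i, v i))
    (hMsym : ∀ j v, (∀ i, v i ∈ I) → ∀ σ : Equiv.Perm (Fin k), M j (v ∘ σ) = M j v)
    (hMcont : ∀ j, ContinuousOn (M j) {v : Fin k → ℝ | ∀ i, v i ∈ I})
    (S : Fin m → (Fin k → ℝ) → ℝ)
    (hSmean : ∀ j v, (∀ i, v i ∈ I) → (⨅ i, v i) ≤ S j v ∧ S j v ≤ (⨆ i, v i))
    (hSsym : ∀ j v, (∀ i, v i ∈ I) → ∀ σ : Equiv.Perm (Fin k), S j (v ∘ σ) = S j v)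
    (hScont : ∀ j, ContinuousOn (S j) {v : Fin k → ℝ | ∀ i, v i ∈ I})
    (hSM : ∀ v : Fin k → ℝ, (∀ i, v i ∈ I) →
      Embedded hmn.le (fun j => S j v) (fun j => M j v))
    (K : (Fin k → ℝ) → ℝ)
    (hK : ∀ v : Fin k → ℝ, (∀ i, v i ∈ I) → K v ∈ I ∧
      μ (padRight (fun j => S j v) (K v)) = μ (fun j => M j v)) :
    ∀ v : Fin k → ℝ, (∀ i, v i ∈ I) → (⨅ i, v i) ≤ K v ∧ K v ≤ (⨆ i, v i) := by
  intro v hv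
  have : Nonempty (Fin k) := ⟨⟨0, hk⟩⟩
  obtain ⟨hKI, hKe⟩ := hK v hv
  obtain ⟨hmaj, hmin⟩ := hSM v hv
  have hbd : ∀ x, (⨅ i, v i) ≤ x ∧ x ≤ (⨆ i, v i) → x ∈ I := by
    intro x hx
    obtain ⟨i, hi⟩ := exists_eq_ciInf_of_finite (f := v)
    obtain ⟨j, hj⟩ := exists_eq_ciSup_of_finite (f := v)
    exact hI.out (hv i) (hv j) ⟨hi ▸ hx.1, hj ▸ hx.2⟩
  have hMI : ∀ j, M j v ∈ I := fun j => hbd _ (hMmean j v hv)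
  have hSI : ∀ j, S j v ∈ I := fun j => hbd _ (hSmean j v hv)
  have hpI : ∀ τ : Equiv.Perm (Fin m), ∀ i,
      (padRight ((fun j => S j v) ∘ τ) (K v) : Fin n → ℝ) i ∈ I := by
    intro τ i
    by_cases h : (i : ℕ) < m
    · simpa [padRight, h] using hSI _
    · simpa [padRight, h] using hKI
  have hpe : ∀ τ : Equiv.Perm (Fin m), ∀ ρ : Equiv.Perm (Fin n),
      μ (padRight ((fun j => S j v) ∘ τ) (K v)) = μ ((fun j => M j v) ∘ ρ) := by
    intro τ ρ
    obtain ⟨σ, hσ⟩ := padRight_perm_aux hmn (fun j => S j v) (K v) τ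
    rw [hσ, hμsym (padRight (fun j => S j v) (K v)) (hpI 1) σ, hμsym _ hMI ρ]
    exact hKe
  constructor
  · by_contra hlt
    push Not at hlt
    let τ : Equiv.Perm (Fin m) := Fin.revPerm.trans (Tuple.sort (fun j => S j v))
    let ρ : Equiv.Perm (Fin n) := Fin.revPerm.trans (Tuple.sort (fun j => M j v))
    have hs : ∀ i : Fin n, ¬ (i : ℕ) < m →
        (padRight ((fun j => S j v) ∘ τ) (K v) : Fin n → ℝ) i < ((fun j => M j v) ∘ ρ) i := by
      intro i h
      simp only [padRight, h, dite_false]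
      exact hlt.trans_le (hMmean _ v hv).1
    refine absurd (hpe τ ρ) (ne_of_lt (mu_strict_aux hμmono (hpI τ) (fun i => hMI _) ?_
      ⟨m, hmn⟩ (hs _ (lt_irrefl m))))
    intro i
    by_cases h : (i : ℕ) < m
    · have := hmaj ⟨i, h⟩
      simp only [padRight, h, dite_true]
      exact this
    · exact (hs i h).le
  · by_contra hlt
    push Not at hlt
    let τ : Equiv.Perm (Fin m) := Tuple.sort (fun j => S j v)
    let ρ : Equiv.Perm (Fin n) := Tuple.sort (fun j => M j v)
    have hs : ∀ i : Fin n, ¬ (i : ℕ) < m →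
        ((fun j => M j v) ∘ ρ) i < (padRight ((fun j => S j v) ∘ τ) (K v) : Fin n → ℝ) i := by
      intro i h
      simp only [padRight, h, dite_false]
      exact (hMmean _ v hv).2.trans_lt hlt
    refine absurd (hpe τ ρ) (ne_of_gt (mu_strict_aux hμmono (fun i => hMI _) (hpI τ) ?_
      ⟨m, hmn⟩ (hs _ (lt_irrefl m))))
    intro i
    by_cases h : (i : ℕ) < m
    · have := hmin ⟨i, h⟩
      simp only [padRight, h, dite_true]
      exact this
    · exact (hs i h).le
end

section
/- Let m ≤ n ∈ ℕ, α ∈ ℝ^m, and β ∈ ℝ^n. Then α ⊲ β if and only if for every k ∈ ℕ and every vector x ∈ ℝ₊^k one has (𝒫_{α_1}(x),…,𝒫_{α_m}(x)) ⊲ (𝒫_{β_1}(x),…,𝒫_{β_n}(x)), where 𝒫_s denotes the k-variable power mean of order s. -/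
/-- The `k`-variable power mean of order `s` of positive reals. -/
noncomputable def powerMean {k : ℕ} (s : ℝ) (x : Fin k → ℝ) : ℝ :=
  if s = 0 then (∏ i, x i) ^ ((k : ℝ)⁻¹) else ((∑ i, x i ^ s) / k) ^ s⁻¹

theorem sortAsc_comp {n : ℕ} (v : Fin n → ℝ) (f : ℝ → ℝ) (hf : Monotone f) (i : Fin n) :
    sortAsc (fun j => f (v j)) i = f (sortAsc v i) := by
  have h1 : Monotone (v ∘ Tuple.sort v) := Tuple.monotone_sort v
  have h2 : Monotone ((fun j => f (v j)) ∘ Tuple.sort v) := fun a b hab => hf (h1 hab)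
  have h3 := (Tuple.comp_sort_eq_comp_iff_monotone (f := fun j => f (v j))).2 h2
  exact (congrFun h3 i).symm

theorem powerMean_const {k : ℕ} (hk : 0 < k) (s c : ℝ) (hc : 0 < c) :
    powerMean s (fun _ : Fin k => c) = c := by
  have hk' : (k : ℝ) ≠ 0 := by positivity
  unfold powerMean
  split_ifs with hs
  · simp only [Finset.prod_const, Finset.card_univ, Fintype.card_fin]
    exact Real.pow_rpow_inv_natCast hc.le hk.ne'
  · simp only [Finset.sum_const, Finset.card_univ, Fintype.card_fin, nsmul_eq_mul]
    rw [mul_div_cancel_left₀ _ hk', Real.rpow_rpow_inv hc.le hs]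

theorem powerMean_neg {k : ℕ} (s : ℝ) (x : Fin k → ℝ) (hx : ∀ i, 0 < x i) :
    powerMean (-s) x = (powerMean s (fun i => (x i)⁻¹))⁻¹ := by
  unfold powerMean
  by_cases hs : s = 0
  · simp only [hs, neg_zero, if_true]
    rw [Finset.prod_inv_distrib, Real.inv_rpow (Finset.prod_nonneg fun i _ => (hx i).le), inv_inv]
  · have h1 : ∀ i, (x i)⁻¹ ^ s = x i ^ (-s) := fun i => by
      rw [Real.inv_rpow (hx i).le, Real.rpow_neg (hx i).le]
    simp only [hs, neg_eq_zero, if_false, h1]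
    rw [inv_neg, Real.rpow_neg]
    exact div_nonneg (Finset.sum_nonneg fun i _ => Real.rpow_nonneg (hx i).le _) (Nat.cast_nonneg _)

theorem powerMean_pos {k : ℕ} (hk : 0 < k) (s : ℝ) (x : Fin k → ℝ) (hx : ∀ i, 0 < x i) :
    0 < powerMean s x := by
  haveI : Nonempty (Fin k) := ⟨⟨0, hk⟩⟩
  have hk' : (0 : ℝ) < k := by exact_mod_cast hk
  unfold powerMean
  split_ifs with hs
  · exact Real.rpow_pos_of_pos (Finset.prod_pos fun i _ => hx i) _
  · exact Real.rpow_pos_of_pos (div_pos (Finset.sum_pos (fun i _ => Real.rpow_pos_of_pos (hx i) _)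
      Finset.univ_nonempty) hk') _

theorem powerMean_lt_zero {k : ℕ} (hk : 0 < k) (s : ℝ) (hs : 0 < s) (x : Fin k → ℝ)
    (hx : ∀ i, 0 < x i) (hne : ∃ i j, x i ≠ x j) : powerMean 0 x < powerMean s x := by
  have hk' : (0 : ℝ) < k := by exact_mod_cast hk
  obtain ⟨a, b, hab⟩ := hne
  have J := strictConvexOn_exp.map_sum_lt (t := Finset.univ) (w := fun _ : Fin k => (k : ℝ)⁻¹)
    (p := fun i => s * Real.log (x i)) (fun i _ => by positivity) (by simp [hk'.ne'])
    (fun i _ => Set.mem_univ _) ⟨a, Finset.mem_univ _, b, Finset.mem_univ _, fun h => hab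
      (Real.log_injOn_pos (hx a) (hx b) (mul_left_cancel₀ hs.ne' h))⟩
  have e : ∀ i, Real.exp (s * Real.log (x i)) = x i ^ s := fun i => by
    rw [Real.rpow_def_of_pos (hx i), mul_comm]
  simp only [smul_eq_mul, ← Finset.mul_sum, e] at J
  have hp : 0 < ∏ i, x i := Finset.prod_pos fun i _ => hx i
  have hS : Real.exp ((k : ℝ)⁻¹ * (s * ∑ i, Real.log (x i))) = ((∏ i, x i) ^ ((k : ℝ)⁻¹)) ^ s := by
    rw [← Real.log_prod (fun i _ => (hx i).ne'), ← Real.rpow_mul hp.le, Real.rpow_def_of_pos hp]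
    congr 1; ring
  rw [hS] at J
  unfold powerMean
  rw [if_pos rfl, if_neg hs.ne', div_eq_inv_mul]
  have h0 : 0 ≤ (∏ i, x i) ^ ((k : ℝ)⁻¹) := Real.rpow_nonneg hp.le _
  calc _ = (((∏ i, x i) ^ ((k : ℝ)⁻¹)) ^ s) ^ s⁻¹ := (Real.rpow_rpow_inv h0 hs.ne').symm
    _ < _ := Real.rpow_lt_rpow (Real.rpow_nonneg h0 _) J (inv_pos.2 hs)

theorem powerMean_lt_pos {k : ℕ} (hk : 0 < k) (t s : ℝ) (ht : 0 < t) (hs : t < s) (x : Fin k → ℝ)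
    (hx : ∀ i, 0 < x i) (hne : ∃ i j, x i ≠ x j) : powerMean t x < powerMean s x := by
  have hk' : (0 : ℝ) < k := by exact_mod_cast hk
  have hs0 : 0 < s := ht.trans hs
  obtain ⟨a, b, hab⟩ := hne
  have J := (strictConvexOn_rpow (p := s / t) ((one_lt_div ht).2 hs)).map_sum_lt
    (t := Finset.univ) (w := fun _ : Fin k => (k : ℝ)⁻¹)
    (p := fun i => x i ^ t) (fun i _ => by positivity) (by simp [hk'.ne'])
    (fun i _ => Real.rpow_nonneg (hx i).le _) ⟨a, Finset.mem_univ _, b, Finset.mem_univ _,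
      fun h => hab (Real.rpow_left_injOn ht.ne' (hx a).le (hx b).le h)⟩
  have e : ∀ i, (x i ^ t) ^ (s / t) = x i ^ s := fun i => by
    rw [← Real.rpow_mul (hx i).le, mul_div_cancel₀ _ ht.ne']
  simp only [smul_eq_mul, ← Finset.mul_sum, e] at J
  unfold powerMean
  rw [if_neg ht.ne', if_neg hs0.ne', div_eq_inv_mul, div_eq_inv_mul]
  have h0 : 0 ≤ (k : ℝ)⁻¹ * ∑ i, x i ^ t :=
    mul_nonneg (by positivity) (Finset.sum_nonneg fun i _ => Real.rpow_nonneg (hx i).le _)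
  have e2 : t⁻¹ = (s / t) * s⁻¹ := by field_simp
  rw [e2, Real.rpow_mul h0]
  exact Real.rpow_lt_rpow (Real.rpow_nonneg h0 _) J (inv_pos.2 hs0)

theorem powerMean_lt_nonneg {k : ℕ} (hk : 0 < k) (t s : ℝ) (ht : 0 ≤ t) (hs : t < s)
    (x : Fin k → ℝ)
    (hx : ∀ i, 0 < x i) (hne : ∃ i j, x i ≠ x j) : powerMean t x < powerMean s x := by
  rcases ht.eq_or_lt with rfl | ht
  · exact powerMean_lt_zero hk s hs x hx hne
  · exact powerMean_lt_pos hk t s ht hs x hx hne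

theorem powerMean_lt_nonpos {k : ℕ} (hk : 0 < k) (t s : ℝ) (h0 : s ≤ 0) (hs : t < s)
    (x : Fin k → ℝ)
    (hx : ∀ i, 0 < x i) (hne : ∃ i j, x i ≠ x j) : powerMean t x < powerMean s x := by
  have h := powerMean_lt_nonneg hk (-s) (-t) (by linarith) (by linarith) (fun i => (x i)⁻¹)
    (fun i => inv_pos.2 (hx i)) (by
      obtain ⟨a, b, hab⟩ := hne
      exact ⟨a, b, fun h => hab (inv_injective h)⟩)
  rw [← neg_neg t, ← neg_neg s, powerMean_neg _ x hx, powerMean_neg _ x hx]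
  exact inv_strictAnti₀ (powerMean_pos hk _ _ fun i => inv_pos.2 (hx i)) h

theorem powerMean_strictMono {k : ℕ} (hk : 0 < k) (x : Fin k → ℝ)
    (hx : ∀ i, 0 < x i) (hne : ∃ i j, x i ≠ x j) : StrictMono (fun s => powerMean s x) := by
  intro t s hts
  rcases le_or_gt 0 t with ht | ht
  · exact powerMean_lt_nonneg hk t s ht hts x hx hne
  rcases le_or_gt s 0 with hs | hs
  · exact powerMean_lt_nonpos hk t s hs hts x hx hne
  · exact (powerMean_lt_nonpos hk t 0 le_rfl ht x hx hne).trans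
      (powerMean_lt_nonneg hk 0 s le_rfl hs x hx hne)

theorem powerMean_monotone {k : ℕ} (hk : 0 < k) (x : Fin k → ℝ)
    (hx : ∀ i, 0 < x i) : Monotone (fun s => powerMean s x) := by
  by_cases hne : ∃ i j, x i ≠ x j
  · exact (powerMean_strictMono hk x hx hne).monotone
  · push Not at hne
    have e : x = fun _ => x ⟨0, hk⟩ := funext fun i => hne _ _
    intro s t _
    change powerMean s x ≤ powerMean t x
    rw [e, powerMean_const hk _ _ (hx _), powerMean_const hk _ _ (hx _)]

/-- `α ⊲ β` if and only if
`(𝒫_{α_1}(x),…,𝒫_{α_m}(x)) ⊲ (𝒫_{β_1}(x),…,𝒫_{β_n}(x))` for every `k ∈ ℕ` and every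
vector `x` of `k` positive reals. -/
theorem embedded_iff_powerMean_embedded (m n : ℕ) (h : m ≤ n)
    (α : Fin m → ℝ) (β : Fin n → ℝ) :
    Embedded h α β ↔
      ∀ (k : ℕ), 0 < k → ∀ x : Fin k → ℝ, (∀ i, 0 < x i) →
        Embedded h (fun j => powerMean (α j) x) (fun j => powerMean (β j) x) := by
  constructor
  · rintro ⟨h1, h2⟩ k hk x hx
    have hm := powerMean_monotone hk x hx
    refine ⟨fun j => ?_, fun j => ?_⟩
    · have := hm (h1 j)
      simp only [sortDesc] at this ⊢
      rw [sortAsc_comp α (fun s => powerMean s x) hm, sortAsc_comp β (fun s => powerMean s x) hm]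
      exact this
    · have := hm (h2 j)
      rw [sortAsc_comp α (fun s => powerMean s x) hm, sortAsc_comp β (fun s => powerMean s x) hm]
      exact this
  · intro H
    have hx : ∀ i : Fin 2, (0 : ℝ) < ![1, 2] i := by
      intro i; fin_cases i <;> simp
    have hm := powerMean_strictMono (k := 2) two_pos ![1, 2] hx ⟨0, 1, by simp⟩
    obtain ⟨h1, h2⟩ := H 2 two_pos ![1, 2] hx
    refine ⟨fun j => ?_, fun j => ?_⟩
    · have := h1 j
      simp only [sortDesc] at this ⊢
      rw [sortAsc_comp α (fun s => powerMean s ![1, 2]) hm.monotone,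
        sortAsc_comp β (fun s => powerMean s ![1, 2]) hm.monotone] at this
      exact hm.le_iff_le.1 this
    · have := h2 j
      rw [sortAsc_comp α (fun s => powerMean s ![1, 2]) hm.monotone,
        sortAsc_comp β (fun s => powerMean s ![1, 2]) hm.monotone] at this
      exact hm.le_iff_le.1 this
end
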